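/- arXiv:math-ph/0503031 — 2 statements merged into one kernel-verified Lean document; each statement's English description precedes it below -/
import Mathlib

section
/- Let ε > 0 and Ỹ > 0, and set S = {φ ∈ ℂ : |Im φ| < Ỹ}. Let K ⊆ S be open such that for every y ∈ (−Ỹ, Ỹ) the horizontal section {t ∈ ℝ : t + iy ∈ K} is a nonempty open interval of length strictly greater than ε. Let f : ℝ × K → ℂ satisfy: (i) for every x ∈ ℝ the map φ ↦ f(x,φ) is holomorphic on K; (ii) f(x+1, φ) = f(x, φ+ε) for every x ∈ ℝ and every φ ∈ K with φ + ε ∈ K. Then there exists a unique function F : ℝ × S → ℂ with F(x,φ) = f(x,φ) for all (x,φ) ∈ ℝ × K, such that for every x ∈ ℝ the map φ ↦ F(x,φ) is holomorphic on S, and F(x+1,φ) = F(x,φ+ε) for all x ∈ ℝ and φ ∈ S. -/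
/-- A consistent function on the strip is invariant under integer shifts of both variables. -/
theorem eq_shift_of_consistent {ε Yt : ℝ} {G : ℝ → ℂ → ℂ}
    (hG : ∀ x : ℝ, ∀ φ : ℂ, |φ.im| < Yt → G (x + 1) φ = G x (φ + ε)) (n : ℤ) (x : ℝ)
    {φ : ℂ} (hφ : |φ.im| < Yt) : G (x + n) (φ - n * ε) = G x φ := by
  have him : ∀ k : ℤ, |(φ - k * ε).im| < Yt := by intro k; simpa using hφ
  induction n using Int.induction_on with
  | zero => simp
  | succ k ih =>
    rw [← ih]
    have h := hG (x + k) (φ - ((k + 1 : ℤ) : ℂ) * ε) (him (k + 1))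
    convert h using 2 <;> push_cast <;> ring
  | pred k ih =>
    rw [← ih]
    have h := hG (x + (-k - 1 : ℤ)) (φ - ((-k : ℤ) : ℂ) * ε) (him (-k))
    convert h.symm using 2 <;> push_cast <;> ring

/-- If integer translates of a point meet `K` in an order-convex set of integers, the shifted
values of a consistent function on `K` agree. -/
theorem shift_eq_of_mem {ε : ℝ} {K : Set ℂ} {f : ℝ → ℂ → ℂ}
    (hcons : ∀ x : ℝ, ∀ φ ∈ K, φ + (ε : ℂ) ∈ K → f (x + 1) φ = f x (φ + ε)) {φ : ℂ}
    (hK : {k : ℤ | φ - k * ε ∈ K}.OrdConnected) (x : ℝ) {n m : ℤ}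
    (hn : φ - n * ε ∈ K) (hm : φ - m * ε ∈ K) :
    f (x + n) (φ - n * ε) = f (x + m) (φ - m * ε) := by
  wlog hnm : n ≤ m generalizing n m
  · exact (this hm hn (le_of_not_ge hnm)).symm
  induction m, hnm using Int.leInduction with
  | base => rfl
  | succ k hk ih =>
    have hkK : φ - k * ε ∈ K := hK.out hn hm ⟨hk, by lia⟩
    rw [ih hkK]
    have e : φ - ((k + 1 : ℤ) : ℂ) * ε + ε = φ - k * ε := by push_cast; ring
    have h := hcons (x + k) _ hm (by rwa [e])
    rw [e] at h
    rw [← h]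
    push_cast
    ring_nf


/-- Lemma `anacoh` of the paper: a consistent function (`f(x+1,φ) = f(x,φ+ε)`),
analytic in `φ` on a domain `K ⊆ S = {|Im φ| < Ỹ}` whose horizontal sections are open
intervals of length `> ε`, extends uniquely to a consistent function analytic in `φ`
on the whole open strip `S`. -/
theorem stmt_3 (ε Yt : ℝ) (hε : 0 < ε) (hYt : 0 < Yt)
    (K : Set ℂ) (hKopen : IsOpen K) (hKsub : K ⊆ {φ : ℂ | |φ.im| < Yt})
    (hsec : ∀ y : ℝ, |y| < Yt → ∃ a b : ℝ, ε < b - a ∧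
      {t : ℝ | (t : ℂ) + (y : ℂ) * Complex.I ∈ K} = Set.Ioo a b)
    (f : ℝ → ℂ → ℂ)
    (hhol : ∀ x : ℝ, DifferentiableOn ℂ (f x) K)
    (hcons : ∀ x : ℝ, ∀ φ ∈ K, φ + (ε : ℂ) ∈ K → f (x + 1) φ = f x (φ + ε)) :
    ∃ F : ℝ → ℂ → ℂ,
      ((∀ x : ℝ, ∀ φ ∈ K, F x φ = f x φ) ∧
       (∀ x : ℝ, DifferentiableOn ℂ (F x) {φ : ℂ | |φ.im| < Yt}) ∧
       (∀ x : ℝ, ∀ φ : ℂ, |φ.im| < Yt → F (x + 1) φ = F x (φ + ε))) ∧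
      ∀ G : ℝ → ℂ → ℂ,
        ((∀ x : ℝ, ∀ φ ∈ K, G x φ = f x φ) ∧
         (∀ x : ℝ, DifferentiableOn ℂ (G x) {φ : ℂ | |φ.im| < Yt}) ∧
         (∀ x : ℝ, ∀ φ : ℂ, |φ.im| < Yt → G (x + 1) φ = G x (φ + ε))) →
        ∀ x : ℝ, ∀ φ : ℂ, |φ.im| < Yt → G x φ = F x φ := by
  have key : ∀ φ : ℂ, |φ.im| < Yt →
      (∃ n : ℤ, φ - n * ε ∈ K) ∧ {k : ℤ | φ - k * ε ∈ K}.OrdConnected := by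
    intro φ hφ
    obtain ⟨a, b, hab, hS⟩ := hsec φ.im hφ
    have hmem : ∀ k : ℤ, φ - k * ε ∈ K ↔ φ.re - k * ε ∈ Set.Ioo a b := by
      intro k
      rw [← hS, Set.mem_ofPred_eq]
      nth_rewrite 1 [← Complex.re_add_im φ]
      push_cast
      ring_nf
    constructor
    · obtain ⟨n, hn, -⟩ := existsUnique_sub_zsmul_mem_Ioc hε φ.re a
      rw [zsmul_eq_mul] at hn
      exact ⟨n, (hmem n).2 ⟨hn.1, by linarith [hn.2]⟩⟩
    · refine ⟨fun n hn m hm k hk => (hmem k).2 ?_⟩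
      have h1 := ((hmem n).1 hn).2
      have h2 := ((hmem m).1 hm).1
      have h3 : (n : ℝ) * ε ≤ k * ε :=
        mul_le_mul_of_nonneg_right (by exact_mod_cast hk.1) hε.le
      have h4 : (k : ℝ) * ε ≤ m * ε :=
        mul_le_mul_of_nonneg_right (by exact_mod_cast hk.2) hε.le
      constructor <;> linarith
  choose N hN using fun φ : {φ : ℂ // |φ.im| < Yt} => (key φ φ.2).1
  classical
  let F : ℝ → ℂ → ℂ := fun x φ =>
    if h : |φ.im| < Yt then f (x + N ⟨φ, h⟩) (φ - N ⟨φ, h⟩ * ε) else 0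
  have hF : ∀ (x : ℝ) (φ : ℂ) (n : ℤ), φ - n * ε ∈ K → F x φ = f (x + n) (φ - n * ε) := by
    intro x φ n hn
    have hφ : |φ.im| < Yt := by simpa using hKsub hn
    simp only [F, dif_pos hφ]
    exact shift_eq_of_mem hcons (key φ hφ).2 x (hN ⟨φ, hφ⟩) hn
  refine ⟨F, ⟨?_, ?_, ?_⟩, ?_⟩
  · intro x φ hφ
    simpa using hF x φ 0 (by simpa using hφ)
  · intro x φ hφ
    obtain ⟨n, hn⟩ := (key φ hφ).1
    have hev : ∀ᶠ z : ℂ in nhds φ, z - n * ε ∈ K :=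
      (continuous_id.sub continuous_const).continuousAt.eventually_mem (hKopen.mem_nhds hn)
    have hd : DifferentiableAt ℂ (fun z : ℂ => f (x + n) (z - n * ε)) φ :=
      ((hhol (x + n)).differentiableAt (hKopen.mem_nhds hn)).comp φ
        (differentiableAt_id.sub_const _)
    exact (hd.congr_of_eventuallyEq
      (hev.mono fun z hz => hF x z n hz)).differentiableWithinAt
  · intro x φ hφ
    obtain ⟨n, hn⟩ := (key φ hφ).1
    have e : φ + ε - ((n + 1 : ℤ) : ℂ) * ε = φ - n * ε := by push_cast; ring
    rw [hF (x + 1) φ n hn, hF x (φ + ε) (n + 1) (by rwa [e]), e]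
    push_cast
    ring_nf
  · rintro G ⟨hGf, -, hG⟩ x φ hφ
    obtain ⟨n, hn⟩ := (key φ hφ).1
    rw [hF x φ n hn, ← hGf _ _ hn, eq_shift_of_consistent hG n x hφ]
end

section
/- Let J = [a,b] be a compact interval, let Φ : J → ℝ be differentiable with Φ'(E) ≥ m > 0 for all E ∈ J, and let ε > 0. Let E₁ ≤ E ≤ E₂ be points of J such that Φ(E₁)/ε ∈ π/2 + πℤ and Φ(E₂) = Φ(E₁) + επ. Then |cos(Φ(E)/ε)| ≥ (2m/(πε)) · min(E − E₁, E₂ − E). -/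
theorem mul_sub_le_image_sub_of_le_hasDerivWithinAt_Icc {f f' : ℝ → ℝ} {a b C : ℝ}
    (hf : ∀ x ∈ Set.Icc a b, HasDerivWithinAt f (f' x) (Set.Icc a b) x)
    (hC : ∀ x ∈ Set.Icc a b, C ≤ f' x) {x y : ℝ} (hx : x ∈ Set.Icc a b)
    (hy : y ∈ Set.Icc a b) (hxy : x ≤ y) : C * (y - x) ≤ f y - f x := by
  have hderiv : ∀ z ∈ interior (Set.Icc a b), HasDerivAt f (f' z) z := fun z hz =>
    (hf z (interior_subset hz)).hasDerivAt (mem_interior_iff_mem_nhds.1 hz)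
  refine (convex_Icc a b).mul_sub_le_image_sub_of_le_deriv
    (fun z hz => (hf z hz).continuousWithinAt)
    (fun z hz => (hderiv z hz).differentiableAt.differentiableWithinAt)
    (fun z hz => ?_) x hx y hy hxy
  rw [(hderiv z hz).deriv]
  exact hC z (interior_subset hz)

theorem mul_min_le_sin {t : ℝ} (h₀ : 0 ≤ t) (hπ : t ≤ Real.pi) :
    2 / Real.pi * min t (Real.pi - t) ≤ Real.sin t := by
  rcases le_total t (Real.pi / 2) with h | h
  · rw [min_eq_left (by linarith)]
    exact Real.mul_le_sin h₀ h
  · rw [min_eq_right (by linarith), ← Real.sin_pi_sub]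
    exact Real.mul_le_sin (by linarith) (by linarith)

theorem abs_cos_pi_div_two_add_int_mul_pi_add (t : ℝ) (k : ℤ) :
    |Real.cos (Real.pi / 2 + k * Real.pi + t)| = |Real.sin t| := by
  rw [show Real.pi / 2 + k * Real.pi + t = t + Real.pi / 2 + k * Real.pi by ring,
    Real.cos_add_int_mul_pi, Real.cos_add_pi_div_two, abs_mul, abs_zpow]
  simp


/-- Inequality (cosinus) of the paper, between two consecutive quantization points:
if `Φ' ≥ m > 0` on `J = [a,b]`, `Φ(E₁)/ε ∈ π/2 + πℤ` and `Φ(E₂) = Φ(E₁) + επ`, then for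
`E₁ ≤ E ≤ E₂` one has `|cos(Φ(E)/ε)| ≥ (2m/(πε)) min(E - E₁, E₂ - E)`. -/
theorem stmt_10 (a b m ε : ℝ) (hm : 0 < m) (hε : 0 < ε)
    (Φ Φ' : ℝ → ℝ)
    (hderiv : ∀ E ∈ Set.Icc a b, HasDerivWithinAt Φ (Φ' E) (Set.Icc a b) E)
    (hlow : ∀ E ∈ Set.Icc a b, m ≤ Φ' E)
    (E₁ E E₂ : ℝ)
    (hE₁ : E₁ ∈ Set.Icc a b) (hE₂ : E₂ ∈ Set.Icc a b)
    (hE : E ∈ Set.Icc E₁ E₂)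
    (hq : ∃ k : ℤ, Φ E₁ / ε = Real.pi / 2 + k * Real.pi)
    (hstep : Φ E₂ = Φ E₁ + ε * Real.pi) :
    2 * m / (Real.pi * ε) * min (E - E₁) (E₂ - E) ≤ |Real.cos (Φ E / ε)| := by
  obtain ⟨k, hk⟩ := hq
  have hEJ : E ∈ Set.Icc a b := ⟨hE₁.1.trans hE.1, hE.2.trans hE₂.2⟩
  have hleft : m * (E - E₁) ≤ Φ E - Φ E₁ :=
    mul_sub_le_image_sub_of_le_hasDerivWithinAt_Icc hderiv hlow hE₁ hEJ hE.1
  have hright : m * (E₂ - E) ≤ Φ E₂ - Φ E :=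
    mul_sub_le_image_sub_of_le_hasDerivWithinAt_Icc hderiv hlow hEJ hE₂ hE.2
  set t := (Φ E - Φ E₁) / ε with ht
  have hleft' : m / ε * (E - E₁) ≤ t := by
    rw [ht, div_mul_eq_mul_div]
    gcongr
  have hright' : m / ε * (E₂ - E) ≤ Real.pi - t := by
    have hsub : Real.pi - t = (Φ E₂ - Φ E) / ε := by
      rw [ht, hstep]
      field_simp
      ring
    rw [hsub, div_mul_eq_mul_div]
    gcongr
  have hmε : 0 ≤ m / ε := by positivity
  have ht₀ : 0 ≤ t := (mul_nonneg hmε (sub_nonneg.2 hE.1)).trans hleft'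
  have htπ : t ≤ Real.pi :=
    sub_nonneg.1 ((mul_nonneg hmε (sub_nonneg.2 hE.2)).trans hright')
  have hphase : Φ E / ε = Real.pi / 2 + k * Real.pi + t := by
    rw [← hk, ht]
    ring
  rw [hphase, abs_cos_pi_div_two_add_int_mul_pi_add]
  calc 2 * m / (Real.pi * ε) * min (E - E₁) (E₂ - E)
      = 2 / Real.pi * (m / ε * min (E - E₁) (E₂ - E)) := by
        rw [mul_div_mul_comm, mul_assoc]
    _ ≤ 2 / Real.pi * min t (Real.pi - t) := by
        rw [mul_min_of_nonneg _ _ hmε]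
        gcongr
    _ ≤ Real.sin t := mul_min_le_sin ht₀ htπ
    _ ≤ |Real.sin t| := le_abs_self _
end
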